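/- arXiv:2508.06705 — 4 statements merged into one kernel-verified Lean document; each statement's English description precedes it below -/
import Mathlib

section
/- Let 𝔤 = 𝔰𝔩₄(ℝ), and let 𝔥₁ = {X ∈ 𝔤 : σ₁(X) = X} and 𝔯₁ = {X ∈ 𝔤 : σ₁(X) = −X} be the fixed and (−1)-eigenspaces of the involution σ₁(X) = −Q₁XᵀQ₁⁻¹. Let 𝔩₁ be the set of matrices of the form with rows (a,b,0,0),(c,−a,0,0),(0,0,a,b),(0,0,c,−a) and 𝔩₂ the set of matrices with rows (a,0,b,0),(0,a,0,b),(c,0,−a,0),(0,c,0,−a), for a,b,c ∈ ℝ. Then: (a) 𝔥₁ = 𝔩₁ ⊕ 𝔩₂, and 𝔩₁, 𝔩₂ are ideals of 𝔥₁ each isomorphic as a Lie algebra to 𝔰𝔩₂(ℝ); (b) if W ⊆ 𝔤 is a linear subspace with {0} ≠ W ≠ 𝔤 which is invariant under the adjoint action of 𝔥₁ (i.e., [X,Y] ∈ W for all X ∈ 𝔥₁ and Y ∈ W), then W = 𝔩₁, or W = 𝔩₂, or W = 𝔥₁, or 𝔯₁ ⊆ W. -/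
open Matrix MeasureTheory
open scoped Classical

noncomputable section

abbrev M4 : Type := Matrix (Fin 4) (Fin 4) ℝ

/-- trace inner product ⟨X,Y⟩ = tr(XYᵀ) -/
def tinner (X Y : M4) : ℝ := (X * Yᵀ).trace

/-- sup norm: maximum absolute value of entries -/
def mnorm (X : M4) : ℝ := ⨆ p : Fin 4 × Fin 4, |X p.1 p.2|

/-- Euclidean (Frobenius) norm -/
def mnorm2 (X : M4) : ℝ := Real.sqrt (tinner X X)

/-- Gram matrices Q₁ (i=0) and Q₂ (i=1) -/
def Qmat (i : Fin 2) : M4 :=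
  if i = 0 then !![0,0,0,-(1/2); 0,0,1/2,0; 0,1/2,0,0; -(1/2),0,0,0]
  else !![0,0,0,-1; 0,1,0,0; 0,0,1,0; -1,0,0,0]

/-- 𝔰𝔩₄(ℝ) as a submodule of 4×4 matrices -/
def sl4 : Submodule ℝ M4 where
  carrier := {X | X.trace = 0}
  add_mem' := by
    intro a b ha hb
    simp only [Set.mem_setOf_eq] at *
    simp [Matrix.trace_add, ha, hb]
  zero_mem' := by simp
  smul_mem' := by
    intro c x hx
    simp only [Set.mem_setOf_eq] at *
    simp [Matrix.trace_smul, hx]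

/-- the involution σᵢ(X) = −QᵢXᵀQᵢ⁻¹ as a linear map -/
def sigmaMap (i : Fin 2) : M4 →ₗ[ℝ] M4 where
  toFun X := -(Qmat i * Xᵀ * (Qmat i)⁻¹)
  map_add' X Y := by
    simp [Matrix.transpose_add, add_mul, mul_add]; abel
  map_smul' c X := by
    simp [Matrix.transpose_smul, Matrix.smul_mul, Matrix.mul_smul]

/-- 𝔯ᵢ = {X ∈ 𝔰𝔩₄ : σᵢ(X) = −X} -/
def rSpace (i : Fin 2) : Submodule ℝ M4 :=
  sl4 ⊓ LinearMap.ker (sigmaMap i + (LinearMap.id : M4 →ₗ[ℝ] M4))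

/-- 𝔥ᵢ = {X ∈ 𝔰𝔩₄ : σᵢ(X) = X} -/
def hSpace (i : Fin 2) : Submodule ℝ M4 :=
  sl4 ⊓ LinearMap.ker (sigmaMap i - (LinearMap.id : M4 →ₗ[ℝ] M4))

/-- 𝐚 = diag(1,0,0,−1) -/
def aWt : M4 := Matrix.diagonal ![1,0,0,-1]

/-- ad(𝐚) = [𝐚, ·] -/
def adA : M4 →ₗ[ℝ] M4 where
  toFun X := aWt * X - X * aWt
  map_add' X Y := by simp [mul_add, add_mul]; abel
  map_smul' c X := by simp [Matrix.mul_smul, Matrix.smul_mul, smul_sub]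

/-- weight space (𝔯ᵢ)_λ -/
def wSpace (i : Fin 2) (lam : ℤ) : Submodule ℝ M4 :=
  rSpace i ⊓ LinearMap.ker (adA - (lam : ℝ) • (LinearMap.id : M4 →ₗ[ℝ] M4))

/-- 𝔯ᵢ^{(λ)} = ⊕_{μ ≥ λ} (𝔯ᵢ)_μ -/
def rUp (i : Fin 2) (lam : ℤ) : Submodule ℝ M4 :=
  ⨆ (μ : ℤ) (_ : lam ≤ μ), wSpace i μ

/-- a_t = diag(e^t, 1, 1, e^{−t}) -/
def aMat (t : ℝ) : M4 := Matrix.diagonal ![Real.exp t, 1, 1, Real.exp (-t)]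

/-- the unipotent elements u^{(i)}_{r,s} -/
def uMat (i : Fin 2) (r s : ℝ) : M4 :=
  if i = 0 then !![1, r, s, s*r; 0,1,0,s; 0,0,1,r; 0,0,0,1]
  else !![1, r, s, (r^2+s^2)/2; 0,1,0,r; 0,0,1,s; 0,0,0,1]

/-- adjoint action g.X = gXg⁻¹ -/
def Adm (g X : M4) : M4 := g * X * g⁻¹

/-- adjoint action as a linear map -/
def AdLin (g : M4) : M4 →ₗ[ℝ] M4 where
  toFun X := g * X * g⁻¹
  map_add' X Y := by simp [mul_add, add_mul]
  map_smul' c X := by simp [Matrix.mul_smul, Matrix.smul_mul]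

/-- the parameter square [−1,1]² -/
def uSq : Set (ℝ × ℝ) := Set.Icc (-1 : ℝ) 1 ×ˢ Set.Icc (-1 : ℝ) 1

/-- m_U = (1/4)·(Lebesgue measure in the parameters) -/
def mU (S : Set (ℝ × ℝ)) : ENNReal := volume S / 4

/-- modified α-energy 𝒢^{(α)}_{F,δ}(w) -/
def energy (α δ : ℝ) (F : Finset M4) (w : M4) : ℝ :=
  ∑ w' ∈ F.erase w, (max (mnorm (w' - w)) δ) ^ (-α)

/-- φ(α) = (1/36)·min{(8/9)α, 1 − α/9} -/
def phiFn (α : ℝ) : ℝ := (1/36) * min ((8/9)*α) (1 - α/9)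

/-- δ-covering number by closed balls for the sup norm -/
def covNum (δ : ℝ) (A : Set M4) : ℕ :=
  sInf {n : ℕ | ∃ t : Finset M4, t.card = n ∧ A ⊆ ⋃ c ∈ t, {y : M4 | mnorm (y - c) ≤ δ}}

/-- orthonormal basis of a subspace, as a tuple -/
def IsONB {n : Type} [Fintype n] (v : n → M4) (V : Submodule ℝ M4) : Prop :=
  (∀ k, v k ∈ V) ∧ (∀ k l, tinner (v k) (v l) = if k = l then 1 else 0) ∧
    Submodule.span ℝ (Set.range v) = V

/-- Gram matrix of a tuple of vectors -/
def gram {n : Type} [Fintype n] (v : n → M4) : Matrix n n ℝ :=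
  Matrix.of fun a b => tinner (v a) (v b)

/-- weights λ₁,…,λ₅ = −2,…,2 -/
def lamOf : Fin 5 → ℤ := ![-2,-1,0,1,2]

/-- dimension differences 𝖽 = (1,2,3,2,1) -/
def dOf : Fin 5 → ℝ := ![1,2,3,2,1]

/-- Index of the atom of 𝒟^𝐫_ρ containing x, for an adapted orthonormal basis b with weights wt. -/
def atomIdx (b : Fin 9 → M4) (wt : Fin 9 → ℤ) (r : Fin 5 → ℝ) (ρ : ℝ) (x : M4) :
    Fin 5 → Fin 9 → ℤ :=
  fun j k => if lamOf j ≤ wt k then ⌊ tinner x (b k) / ρ ^ (r j) ⌋ else 0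

end

/-- 𝔰𝔩₂(ℝ) as a submodule of 2×2 matrices -/
def sl2 : Submodule ℝ (Matrix (Fin 2) (Fin 2) ℝ) where
  carrier := {X | X.trace = 0}
  add_mem' := by
    intro a b ha hb
    simp only [Set.mem_setOf_eq] at *
    simp [Matrix.trace_add, ha, hb]
  zero_mem' := by simp
  smul_mem' := by
    intro c x hx
    simp only [Set.mem_setOf_eq] at *
    simp [Matrix.trace_smul, hx]

/-- 𝔩₁: matrices with rows (a,b,0,0),(c,−a,0,0),(0,0,a,b),(0,0,c,−a) -/
def lFac1 : Submodule ℝ M4 :=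
  Submodule.span ℝ
    ({!![1,0,0,0; 0,-1,0,0; 0,0,1,0; 0,0,0,-1],
      !![0,1,0,0; 0,0,0,0; 0,0,0,1; 0,0,0,0],
      !![0,0,0,0; 1,0,0,0; 0,0,0,0; 0,0,1,0]} : Set M4)

/-- 𝔩₂: matrices with rows (a,0,b,0),(0,a,0,b),(c,0,−a,0),(0,c,0,−a) -/
def lFac2 : Submodule ℝ M4 :=
  Submodule.span ℝ
    ({!![1,0,0,0; 0,1,0,0; 0,0,-1,0; 0,0,0,-1],
      !![0,0,1,0; 0,0,0,1; 0,0,0,0; 0,0,0,0],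
      !![0,0,0,0; 0,0,0,0; 1,0,0,0; 0,1,0,0]} : Set M4)

/-- The Kronecker product of two real 2×2 matrices, as a bilinear map into 4×4 matrices. -/
noncomputable def kron : Matrix (Fin 2) (Fin 2) ℝ →ₗ[ℝ] Matrix (Fin 2) (Fin 2) ℝ →ₗ[ℝ] M4 :=
  LinearMap.mk₂ ℝ
    (fun A B => !![A 0 0 * B 0 0, A 0 0 * B 0 1, A 0 1 * B 0 0, A 0 1 * B 0 1;
                   A 0 0 * B 1 0, A 0 0 * B 1 1, A 0 1 * B 1 0, A 0 1 * B 1 1;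
                   A 1 0 * B 0 0, A 1 0 * B 0 1, A 1 1 * B 0 0, A 1 1 * B 0 1;
                   A 1 0 * B 1 0, A 1 0 * B 1 1, A 1 1 * B 1 0, A 1 1 * B 1 1])
    (by intro A A' B; ext i j; fin_cases i <;> fin_cases j <;> simp [add_mul])
    (by intro c A B; ext i j; fin_cases i <;> fin_cases j <;> simp [mul_assoc])
    (by intro A B B'; ext i j; fin_cases i <;> fin_cases j <;> simp [mul_add])
    (by intro c A B; ext i j; fin_cases i <;> fin_cases j <;> simp [mul_left_comm])

theorem kron_apply (A B : Matrix (Fin 2) (Fin 2) ℝ) :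
    kron A B = !![A 0 0 * B 0 0, A 0 0 * B 0 1, A 0 1 * B 0 0, A 0 1 * B 0 1;
                  A 0 0 * B 1 0, A 0 0 * B 1 1, A 0 1 * B 1 0, A 0 1 * B 1 1;
                  A 1 0 * B 0 0, A 1 0 * B 0 1, A 1 1 * B 0 0, A 1 1 * B 0 1;
                  A 1 0 * B 1 0, A 1 0 * B 1 1, A 1 1 * B 1 0, A 1 1 * B 1 1] := rfl

theorem kron_mul_kron (A B C D : Matrix (Fin 2) (Fin 2) ℝ) :
    kron A B * kron C D = kron (A * C) (B * D) := by
  ext i j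
  fin_cases i <;> fin_cases j <;>
    simp [kron_apply, Matrix.mul_apply, Fin.sum_univ_four] <;> ring

theorem kron_one_right_bracket (a A B : Matrix (Fin 2) (Fin 2) ℝ) :
    kron a 1 * kron A B - kron A B * kron a 1 = kron (a * A - A * a) B := by
  simp [kron_mul_kron]

theorem kron_one_left_bracket (b A B : Matrix (Fin 2) (Fin 2) ℝ) :
    kron 1 b * kron A B - kron A B * kron 1 b = kron A (b * B - B * b) := by
  simp [kron_mul_kron]

theorem mem_sl2_iff {A : Matrix (Fin 2) (Fin 2) ℝ} : A ∈ sl2 ↔ A 1 1 = -A 0 0 := by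
  change A.trace = 0 ↔ _
  rw [Matrix.trace_fin_two]
  constructor <;> intro h <;> linarith

theorem bracket_mem_sl2 (A B : Matrix (Fin 2) (Fin 2) ℝ) : A * B - B * A ∈ sl2 := by
  change (A * B - B * A).trace = 0
  rw [Matrix.trace_sub, Matrix.trace_mul_comm, sub_self]

theorem mem_sl4_iff {X : M4} : X ∈ sl4 ↔ X 3 3 = -(X 0 0 + X 1 1 + X 2 2) := by
  change X.trace = 0 ↔ _
  simp only [Matrix.trace, Matrix.diag, Fin.sum_univ_four]
  constructor <;> intro h <;> linarith

/-- The raising element of the standard basis of 𝔰𝔩₂(ℝ). -/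
noncomputable def sl2E : Matrix (Fin 2) (Fin 2) ℝ := !![0, 1; 0, 0]

/-- The semisimple element of the standard basis of 𝔰𝔩₂(ℝ). -/
noncomputable def sl2H : Matrix (Fin 2) (Fin 2) ℝ := !![1, 0; 0, -1]

/-- The lowering element of the standard basis of 𝔰𝔩₂(ℝ). -/
noncomputable def sl2F : Matrix (Fin 2) (Fin 2) ℝ := !![0, 0; 1, 0]

theorem sl2E_mem : sl2E ∈ sl2 := by simp [mem_sl2_iff, sl2E]

theorem sl2H_mem : sl2H ∈ sl2 := by simp [mem_sl2_iff, sl2H]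

theorem sl2F_mem : sl2F ∈ sl2 := by simp [mem_sl2_iff, sl2F]

theorem sl2E_ne_zero : sl2E ≠ 0 := fun h => by simpa [sl2E] using congrFun (congrFun h 0) 1

theorem sl2H_ne_zero : sl2H ≠ 0 := fun h => by simpa [sl2H] using congrFun (congrFun h 0) 0

theorem sl2F_ne_zero : sl2F ≠ 0 := fun h => by simpa [sl2F] using congrFun (congrFun h 1) 0

theorem eq_combination_of_mem_sl2 {A : Matrix (Fin 2) (Fin 2) ℝ} (hA : A ∈ sl2) :
    A = A 0 1 • sl2E + A 0 0 • sl2H + A 1 0 • sl2F := by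
  rw [mem_sl2_iff] at hA
  ext i j
  fin_cases i <;> fin_cases j <;> simp [sl2E, sl2H, sl2F, hA]

theorem sl2E_bracket_bracket (A : Matrix (Fin 2) (Fin 2) ℝ) :
    sl2E * (sl2E * A - A * sl2E) - (sl2E * A - A * sl2E) * sl2E = (-2 * A 1 0) • sl2E := by
  rw [Matrix.eta_fin_two A]
  ext i j
  fin_cases i <;> fin_cases j <;>
    simp [sl2E]
  ring

theorem sl2F_bracket_bracket (A : Matrix (Fin 2) (Fin 2) ℝ) :
    sl2F * (sl2F * A - A * sl2F) - (sl2F * A - A * sl2F) * sl2F = (-2 * A 0 1) • sl2F := by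
  rw [Matrix.eta_fin_two A]
  ext i j
  fin_cases i <;> fin_cases j <;>
    simp [sl2F]
  ring

theorem sl2E_bracket_sl2F : sl2E * sl2F - sl2F * sl2E = sl2H := by
  ext i j
  fin_cases i <;> fin_cases j <;> simp [sl2E, sl2F, sl2H]

theorem sl2E_bracket_sl2H : sl2E * sl2H - sl2H * sl2E = (-2 : ℝ) • sl2E := by
  ext i j
  fin_cases i <;> fin_cases j <;>
    simp [sl2E, sl2H]
  norm_num

/-- The adjoint representation of 𝔰𝔩₂(ℝ) is irreducible. -/
theorem sl2_le_of_invariant {U : Submodule ℝ (Matrix (Fin 2) (Fin 2) ℝ)}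
    (hU : ∀ a ∈ sl2, ∀ A ∈ U, a * A - A * a ∈ U)
    {A : Matrix (Fin 2) (Fin 2) ℝ} (hA : A ∈ sl2) (hA0 : A ≠ 0) (hAU : A ∈ U) : sl2 ≤ U := by
  have cancel : ∀ {c : ℝ} {B : Matrix (Fin 2) (Fin 2) ℝ}, c ≠ 0 → c • B ∈ U → B ∈ U :=
    fun hc h => (U.smul_mem_iff hc).1 h
  have hEE := hU _ sl2E_mem _ (hU _ sl2E_mem _ hAU)
  have hFF := hU _ sl2F_mem _ (hU _ sl2F_mem _ hAU)
  rw [sl2E_bracket_bracket] at hEE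
  rw [sl2F_bracket_bracket] at hFF
  have of_E : sl2E ∈ U → sl2F ∈ U := fun h => by
    have := hU _ sl2F_mem _ (hU _ sl2F_mem _ h)
    rw [sl2F_bracket_bracket] at this
    exact cancel (by simp [sl2E]) this
  have of_F : sl2F ∈ U → sl2E ∈ U := fun h => by
    have := hU _ sl2E_mem _ (hU _ sl2E_mem _ h)
    rw [sl2E_bracket_bracket] at this
    exact cancel (by simp [sl2F]) this
  have hE : sl2E ∈ U := by
    by_cases h10 : A 1 0 = 0
    · by_cases h01 : A 0 1 = 0
      · have hAH := eq_combination_of_mem_sl2 hA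
        rw [h10, h01, zero_smul, zero_smul, zero_add, add_zero] at hAH
        have h00 : A 0 0 ≠ 0 := fun h => hA0 (by rw [hAH, h, zero_smul])
        have hH : sl2H ∈ U := cancel h00 (hAH ▸ hAU)
        have := hU _ sl2E_mem _ hH
        rw [sl2E_bracket_sl2H] at this
        exact cancel (by norm_num) this
      · exact of_F (cancel (by simpa using h01) hFF)
    · exact cancel (by simpa using h10) hEE
  have hF := of_E hE
  have hH : sl2H ∈ U := sl2E_bracket_sl2F ▸ hU _ sl2E_mem _ hF
  intro B hB
  rw [eq_combination_of_mem_sl2 hB]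
  exact U.add_mem (U.add_mem (U.smul_mem _ hE) (U.smul_mem _ hH)) (U.smul_mem _ hF)

theorem mem_lFac1_iff {X : M4} : X ∈ lFac1 ↔ ∃ b ∈ sl2, X = kron 1 b := by
  rw [lFac1, Submodule.mem_span_triple]
  constructor
  · rintro ⟨a, b, c, rfl⟩
    refine ⟨!![a, b; c, -a], by simp [mem_sl2_iff], ?_⟩
    ext i j
    fin_cases i <;> fin_cases j <;> simp [kron_apply]
  · rintro ⟨b, hb, rfl⟩
    rw [mem_sl2_iff] at hb
    refine ⟨b 0 0, b 0 1, b 1 0, ?_⟩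
    ext i j
    fin_cases i <;> fin_cases j <;> simp [kron_apply, hb]

theorem mem_lFac2_iff {X : M4} : X ∈ lFac2 ↔ ∃ a ∈ sl2, X = kron a 1 := by
  rw [lFac2, Submodule.mem_span_triple]
  constructor
  · rintro ⟨a, b, c, rfl⟩
    refine ⟨!![a, b; c, -a], by simp [mem_sl2_iff], ?_⟩
    ext i j
    fin_cases i <;> fin_cases j <;> simp [kron_apply]
  · rintro ⟨a, ha, rfl⟩
    rw [mem_sl2_iff] at ha
    refine ⟨a 0 0, a 0 1, a 1 0, ?_⟩
    ext i j
    fin_cases i <;> fin_cases j <;> simp [kron_apply, ha]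

theorem sigmaMap_zero_apply (X : M4) :
    sigmaMap 0 X = !![-X 3 3, X 2 3, X 1 3, -X 0 3;
                      X 3 2, -X 2 2, -X 1 2, X 0 2;
                      X 3 1, -X 2 1, -X 1 1, X 0 1;
                      -X 3 0, X 2 0, X 1 0, -X 0 0] := by
  have hinv : (Qmat 0)⁻¹ = !![0,0,0,-2; 0,0,2,0; 0,2,0,0; -2,0,0,0] := by
    apply Matrix.inv_eq_right_inv
    ext i j
    fin_cases i <;> fin_cases j <;> simp [Qmat]
  change -(Qmat 0 * Xᵀ * (Qmat 0)⁻¹) = _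
  rw [hinv]
  ext i j
  simp only [Matrix.neg_apply, Matrix.mul_apply, Fin.sum_univ_four, Matrix.transpose_apply]
  fin_cases i <;> fin_cases j <;> simp [Qmat] <;> ring

theorem mem_hSpace_zero_iff {X : M4} :
    X ∈ hSpace 0 ↔ ∃ a ∈ sl2, ∃ b ∈ sl2, X = kron a 1 + kron 1 b := by
  rw [hSpace, Submodule.mem_inf, LinearMap.mem_ker, LinearMap.sub_apply, LinearMap.id_apply,
    sub_eq_zero, sigmaMap_zero_apply, mem_sl4_iff]
  constructor
  · rintro ⟨-, h⟩
    have h' := fun i j => congrFun (congrFun h i) j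
    simp [Fin.forall_fin_succ] at h'
    refine ⟨!![(X 0 0 + X 1 1) / 2, X 0 2; X 2 0, -((X 0 0 + X 1 1) / 2)], by simp [mem_sl2_iff],
      !![(X 0 0 - X 1 1) / 2, X 0 1; X 1 0, -((X 0 0 - X 1 1) / 2)], by simp [mem_sl2_iff], ?_⟩
    ext i j
    fin_cases i <;> fin_cases j <;> simp [kron_apply] <;> linarith
  · rintro ⟨a, ha, b, hb, rfl⟩
    rw [mem_sl2_iff] at ha hb
    refine ⟨by simp [kron_apply, ha, hb]; ring, ?_⟩
    ext i j
    fin_cases i <;> fin_cases j <;> simp [kron_apply, ha, hb] <;> ring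

/-- 𝔰𝔩₄(ℝ) = 𝔰𝔩₂ ⊗ 1 + 1 ⊗ 𝔰𝔩₂ + 𝔰𝔩₂ ⊗ 𝔰𝔩₂. -/
theorem exists_kron_decomposition {X : M4} (hX : X ∈ sl4) :
    ∃ a ∈ sl2, ∃ b ∈ sl2, ∃ p ∈ sl2, ∃ q ∈ sl2, ∃ s ∈ sl2,
      X = kron a 1 + kron 1 b + (kron sl2E p + kron sl2H q + kron sl2F s) := by
  rw [mem_sl4_iff] at hX
  refine ⟨!![(X 0 0 + X 1 1) / 2, (X 0 2 + X 1 3) / 2;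
      (X 2 0 + X 3 1) / 2, -((X 0 0 + X 1 1) / 2)], by simp [mem_sl2_iff],
    !![(X 0 0 + X 2 2) / 2, (X 0 1 + X 2 3) / 2;
      (X 1 0 + X 3 2) / 2, -((X 0 0 + X 2 2) / 2)], by simp [mem_sl2_iff],
    !![(X 0 2 - X 1 3) / 2, X 0 3; X 1 2, -((X 0 2 - X 1 3) / 2)], by simp [mem_sl2_iff],
    !![-(X 1 1 + X 2 2) / 2, (X 0 1 - X 2 3) / 2;
      (X 1 0 - X 3 2) / 2, -(-(X 1 1 + X 2 2) / 2)], by simp [mem_sl2_iff],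
    !![(X 2 0 - X 3 1) / 2, X 2 1; X 3 0, -((X 2 0 - X 3 1) / 2)], by simp [mem_sl2_iff], ?_⟩
  ext i j
  fin_cases i <;> fin_cases j <;> simp [kron_apply, sl2E, sl2H, sl2F] <;> linarith

theorem exists_kron_of_mem_rSpace {X : M4} (hX : X ∈ rSpace 0) :
    ∃ p ∈ sl2, ∃ q ∈ sl2, ∃ s ∈ sl2, X = kron sl2E p + kron sl2H q + kron sl2F s := by
  rw [rSpace, Submodule.mem_inf, LinearMap.mem_ker, LinearMap.add_apply, LinearMap.id_apply,
    sigmaMap_zero_apply, mem_sl4_iff] at hX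
  obtain ⟨hX, h⟩ := hX
  have h' := fun i j => congrFun (congrFun h i) j
  simp [Fin.forall_fin_succ] at h'
  refine ⟨!![X 0 2, X 0 3; X 1 2, -X 0 2], by simp [mem_sl2_iff],
    !![X 0 0, X 0 1; X 1 0, -X 0 0], by simp [mem_sl2_iff],
    !![X 2 0, X 2 1; X 3 0, -X 2 0], by simp [mem_sl2_iff], ?_⟩
  ext i j
  fin_cases i <;> fin_cases j <;> simp [kron_apply, sl2E, sl2H, sl2F] <;> linarith

/-- The commutator with a fixed matrix, as a linear map. -/
noncomputable def commutatorMap {n : Type*} [Fintype n] [DecidableEq n] (h : Matrix n n ℝ) :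
    Matrix n n ℝ →ₗ[ℝ] Matrix n n ℝ :=
  LinearMap.mulLeft ℝ h - LinearMap.mulRight ℝ h

/-- The Casimir operator of the triple `e, h, f` in the adjoint representation. -/
noncomputable def casimir {n : Type*} [Fintype n] [DecidableEq n] (e h f : Matrix n n ℝ) :
    Matrix n n ℝ →ₗ[ℝ] Matrix n n ℝ :=
  (1 / 2 : ℝ) • (commutatorMap h ∘ₗ commutatorMap h) + commutatorMap e ∘ₗ commutatorMap f +
    commutatorMap f ∘ₗ commutatorMap e

theorem casimir_apply {n : Type*} [Fintype n] [DecidableEq n] (e h f X : Matrix n n ℝ) :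
    casimir e h f X = (1 / 2 : ℝ) • (h * (h * X - X * h) - (h * X - X * h) * h) +
      (e * (f * X - X * f) - (f * X - X * f) * e) +
      (f * (e * X - X * e) - (e * X - X * e) * f) := rfl

theorem casimir_sl2 {A : Matrix (Fin 2) (Fin 2) ℝ} (hA : A ∈ sl2) :
    casimir sl2E sl2H sl2F A = (4 : ℝ) • A := by
  rw [mem_sl2_iff] at hA
  rw [casimir_apply, Matrix.eta_fin_two A, hA]
  ext i j
  fin_cases i <;> fin_cases j <;> simp [sl2E, sl2H, sl2F] <;> ring

theorem casimir_one {n : Type*} [Fintype n] [DecidableEq n] (e h f : Matrix n n ℝ) :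
    casimir e h f 1 = 0 := by
  simp [casimir_apply]

theorem casimir_kron_left (e h f A B : Matrix (Fin 2) (Fin 2) ℝ) :
    casimir (kron e 1) (kron h 1) (kron f 1) (kron A B) = kron (casimir e h f A) B := by
  simp only [casimir_apply, kron_one_right_bracket, map_add, map_smul, LinearMap.add_apply,
    LinearMap.smul_apply]

theorem casimir_kron_right (e h f A B : Matrix (Fin 2) (Fin 2) ℝ) :
    casimir (kron 1 e) (kron 1 h) (kron 1 f) (kron A B) = kron A (casimir e h f B) := by
  simp only [casimir_apply, kron_one_left_bracket, map_add, map_smul]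

theorem casimir_mem {n : Type*} [Fintype n] [DecidableEq n] {W : Submodule ℝ (Matrix n n ℝ)}
    {e h f X : Matrix n n ℝ} (he : ∀ Y ∈ W, e * Y - Y * e ∈ W) (hh : ∀ Y ∈ W, h * Y - Y * h ∈ W)
    (hf : ∀ Y ∈ W, f * Y - Y * f ∈ W) (hX : X ∈ W) : casimir e h f X ∈ W := by
  rw [casimir_apply]
  exact W.add_mem (W.add_mem (W.smul_mem _ (hh _ (hh _ hX))) (he _ (hf _ hX))) (hf _ (he _ hX))

section Invariant

variable {W : Submodule ℝ M4}

/-- An invariant subspace contains the isotypic components of its elements. -/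
theorem isotypic_components_mem
    (hL : ∀ c ∈ sl2, ∀ Y ∈ W, kron c 1 * Y - Y * kron c 1 ∈ W)
    (hR : ∀ c ∈ sl2, ∀ Y ∈ W, kron 1 c * Y - Y * kron 1 c ∈ W)
    {a b p q s : Matrix (Fin 2) (Fin 2) ℝ} (ha : a ∈ sl2) (hb : b ∈ sl2) (hp : p ∈ sl2)
    (hq : q ∈ sl2) (hs : s ∈ sl2)
    (hX : kron a 1 + kron 1 b + (kron sl2E p + kron sl2H q + kron sl2F s) ∈ W) :
    kron a 1 ∈ W ∧ kron 1 b ∈ W ∧ kron sl2E p + kron sl2H q + kron sl2F s ∈ W := by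
  have h1 := casimir_mem (hL _ sl2E_mem) (hL _ sl2H_mem) (hL _ sl2F_mem) hX
  have h2 := casimir_mem (hR _ sl2E_mem) (hR _ sl2H_mem) (hR _ sl2F_mem) hX
  simp only [map_add, casimir_kron_left, casimir_one, casimir_sl2 ha, casimir_sl2 sl2E_mem,
    casimir_sl2 sl2H_mem, casimir_sl2 sl2F_mem, map_smul, map_zero, LinearMap.smul_apply,
    LinearMap.zero_apply, add_zero] at h1
  simp only [map_add, casimir_kron_right, casimir_one, casimir_sl2 hb, casimir_sl2 hp,
    casimir_sl2 hq, casimir_sl2 hs, map_smul, map_zero, zero_add] at h2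
  have h1' := W.smul_mem (1 / 4 : ℝ) h1
  have h2' := W.smul_mem (1 / 4 : ℝ) h2
  refine ⟨?_, ?_, ?_⟩
  · convert W.sub_mem hX h2' using 1
    module
  · convert W.sub_mem hX h1' using 1
    module
  · convert W.sub_mem (W.add_mem h1' h2') hX using 1
    module

theorem sl2H_bracket_sl2E : sl2H * sl2E - sl2E * sl2H = (2 : ℝ) • sl2E := by
  rw [← neg_sub, sl2E_bracket_sl2H, neg_smul, neg_neg]

theorem sl2H_bracket_sl2F : sl2H * sl2F - sl2F * sl2H = (-2 : ℝ) • sl2F := by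
  ext i j
  fin_cases i <;> fin_cases j <;> simp [sl2H, sl2F]
  norm_num

/-- An invariant subspace contains the weight components of its elements. -/
theorem weight_components_mem
    (hL : ∀ c ∈ sl2, ∀ Y ∈ W, kron c 1 * Y - Y * kron c 1 ∈ W)
    {p q s : Matrix (Fin 2) (Fin 2) ℝ}
    (hX : kron sl2E p + kron sl2H q + kron sl2F s ∈ W) :
    kron sl2E p ∈ W ∧ kron sl2H q ∈ W ∧ kron sl2F s ∈ W := by
  have bracket : ∀ p q s : Matrix (Fin 2) (Fin 2) ℝ,
      kron sl2H 1 * (kron sl2E p + kron sl2H q + kron sl2F s) -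
        (kron sl2E p + kron sl2H q + kron sl2F s) * kron sl2H 1 =
      kron sl2E ((2 : ℝ) • p) + kron sl2H 0 + kron sl2F ((-2 : ℝ) • s) := by
    intro p q s
    have hE := kron_one_right_bracket sl2H sl2E p
    have hH := kron_one_right_bracket sl2H sl2H q
    have hF := kron_one_right_bracket sl2H sl2F s
    rw [sl2H_bracket_sl2E] at hE
    rw [sl2H_bracket_sl2F] at hF
    rw [sub_self] at hH
    simp only [map_smul, map_zero, LinearMap.smul_apply, LinearMap.zero_apply] at hE hH hF ⊢
    rw [← hE, ← hF, ← hH]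
    noncomm_ring
  have h1 := hL _ sl2H_mem _ hX
  rw [bracket] at h1
  have h2 := hL _ sl2H_mem _ h1
  rw [bracket] at h2
  simp only [map_smul, map_zero, add_zero] at h1 h2
  have hE : kron sl2E p ∈ W := by
    convert W.smul_mem (1 / 8 : ℝ) (W.add_mem h2 (W.smul_mem (2 : ℝ) h1)) using 1
    module
  have hF : kron sl2F s ∈ W := by
    convert W.smul_mem (1 / 8 : ℝ) (W.sub_mem h2 (W.smul_mem (2 : ℝ) h1)) using 1
    module
  refine ⟨hE, ?_, hF⟩
  convert W.sub_mem (W.sub_mem hX hE) hF using 1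
  module

theorem kron_mem_of_left_mem
    (hL : ∀ c ∈ sl2, ∀ Y ∈ W, kron c 1 * Y - Y * kron c 1 ∈ W)
    {a b : Matrix (Fin 2) (Fin 2) ℝ} (ha : a ∈ sl2) (ha0 : a ≠ 0) (hab : kron a b ∈ W) :
    ∀ c ∈ sl2, kron c b ∈ W := by
  refine sl2_le_of_invariant (U := W.comap (kron.flip b)) (fun c hc A hA => ?_) ha ha0 hab
  change kron (c * A - A * c) b ∈ W
  rw [← kron_one_right_bracket]
  exact hL c hc _ hA

theorem kron_mem_of_right_mem
    (hR : ∀ c ∈ sl2, ∀ Y ∈ W, kron 1 c * Y - Y * kron 1 c ∈ W)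
    {a b : Matrix (Fin 2) (Fin 2) ℝ} (hb : b ∈ sl2) (hb0 : b ≠ 0) (hab : kron a b ∈ W) :
    ∀ c ∈ sl2, kron a c ∈ W := by
  refine sl2_le_of_invariant (U := W.comap (kron a)) (fun c hc A hA => ?_) hb hb0 hab
  change kron a (c * A - A * c) ∈ W
  rw [← kron_one_left_bracket]
  exact hR c hc _ hA

theorem rSpace_le_of_kron_mem
    (hL : ∀ c ∈ sl2, ∀ Y ∈ W, kron c 1 * Y - Y * kron c 1 ∈ W)
    (hR : ∀ c ∈ sl2, ∀ Y ∈ W, kron 1 c * Y - Y * kron 1 c ∈ W)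
    {a b : Matrix (Fin 2) (Fin 2) ℝ} (ha : a ∈ sl2) (ha0 : a ≠ 0) (hb : b ∈ sl2) (hb0 : b ≠ 0)
    (hab : kron a b ∈ W) : rSpace 0 ≤ W := by
  have key : ∀ c ∈ sl2, ∀ d ∈ sl2, kron c d ∈ W := fun c hc d hd =>
    kron_mem_of_left_mem hL ha ha0 (kron_mem_of_right_mem hR hb hb0 hab d hd) c hc
  intro X hX
  obtain ⟨p, hp, q, hq, s, hs, rfl⟩ := exists_kron_of_mem_rSpace hX
  exact W.add_mem (W.add_mem (key _ sl2E_mem _ hp) (key _ sl2H_mem _ hq)) (key _ sl2F_mem _ hs)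

end Invariant

theorem lFac1_le_hSpace : lFac1 ≤ hSpace 0 := by
  intro X hX
  obtain ⟨b, hb, rfl⟩ := mem_lFac1_iff.1 hX
  exact mem_hSpace_zero_iff.2 ⟨0, sl2.zero_mem, b, hb, by simp⟩

theorem lFac2_le_hSpace : lFac2 ≤ hSpace 0 := by
  intro X hX
  obtain ⟨a, ha, rfl⟩ := mem_lFac2_iff.1 hX
  exact mem_hSpace_zero_iff.2 ⟨a, ha, 0, sl2.zero_mem, by simp⟩

theorem hSpace_eq_sup : hSpace 0 = lFac1 ⊔ lFac2 := by
  refine le_antisymm (fun X hX => ?_) (sup_le lFac1_le_hSpace lFac2_le_hSpace)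
  obtain ⟨a, ha, b, hb, rfl⟩ := mem_hSpace_zero_iff.1 hX
  exact Submodule.add_mem _
    (Submodule.mem_sup_right (mem_lFac2_iff.2 ⟨a, ha, rfl⟩))
    (Submodule.mem_sup_left (mem_lFac1_iff.2 ⟨b, hb, rfl⟩))

theorem lFac1_inf_lFac2 : lFac1 ⊓ lFac2 = ⊥ := by
  rw [eq_bot_iff]
  rintro X ⟨h1, h2⟩
  obtain ⟨b, hb, rfl⟩ := mem_lFac1_iff.1 h1
  obtain ⟨a, ha, hab⟩ := mem_lFac2_iff.1 h2
  rw [mem_sl2_iff] at ha hb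
  have h := fun i j => congrFun (congrFun hab i) j
  simp [kron_apply, Fin.forall_fin_succ, ha, hb] at h
  rw [Submodule.mem_bot]
  ext i j
  fin_cases i <;> fin_cases j <;> simp [kron_apply, hb] <;> linarith

theorem bracket_mem_lFac1 {X Y : M4} (hX : X ∈ hSpace 0) (hY : Y ∈ lFac1) :
    X * Y - Y * X ∈ lFac1 := by
  obtain ⟨a, ha, b, hb, rfl⟩ := mem_hSpace_zero_iff.1 hX
  obtain ⟨c, hc, rfl⟩ := mem_lFac1_iff.1 hY
  refine mem_lFac1_iff.2 ⟨b * c - c * b, bracket_mem_sl2 b c, ?_⟩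
  simp [add_mul, mul_add, kron_mul_kron]

theorem bracket_mem_lFac2 {X Y : M4} (hX : X ∈ hSpace 0) (hY : Y ∈ lFac2) :
    X * Y - Y * X ∈ lFac2 := by
  obtain ⟨a, ha, b, hb, rfl⟩ := mem_hSpace_zero_iff.1 hX
  obtain ⟨c, hc, rfl⟩ := mem_lFac2_iff.1 hY
  refine mem_lFac2_iff.2 ⟨a * c - c * a, bracket_mem_sl2 a c, ?_⟩
  simp [add_mul, mul_add, kron_mul_kron]

theorem exists_bracket_iso_of_section {L : Submodule ℝ M4}
    (φ : Matrix (Fin 2) (Fin 2) ℝ →ₗ[ℝ] M4) (f : M4 →ₗ[ℝ] Matrix (Fin 2) (Fin 2) ℝ)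
    (hL : ∀ X, X ∈ L ↔ ∃ b ∈ sl2, X = φ b) (hf : ∀ b, f (φ b) = b)
    (hφ : ∀ a b, φ a * φ b = φ (a * b)) :
    Submodule.map f L = sl2 ∧ Set.InjOn f (L : Set M4) ∧
      ∀ X ∈ L, ∀ Y ∈ L, f (X * Y - Y * X) = f X * f Y - f Y * f X := by
  refine ⟨?_, ?_, ?_⟩
  · ext b
    rw [Submodule.mem_map]
    constructor
    · rintro ⟨X, hX, rfl⟩
      obtain ⟨c, hc, rfl⟩ := (hL X).1 hX
      rwa [hf]
    · exact fun hb => ⟨φ b, (hL _).2 ⟨b, hb, rfl⟩, hf b⟩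
  · intro X hX Y hY h
    obtain ⟨a, -, rfl⟩ := (hL X).1 hX
    obtain ⟨b, -, rfl⟩ := (hL Y).1 hY
    rw [hf, hf] at h
    rw [h]
  · intro X hX Y hY
    obtain ⟨a, -, rfl⟩ := (hL X).1 hX
    obtain ⟨b, -, rfl⟩ := (hL Y).1 hY
    rw [hφ, hφ, ← map_sub, hf, hf, hf]

theorem eq_lFac_or_rSpace_le {W : Submodule ℝ M4} (hW : W ≤ sl4) (hW0 : W ≠ ⊥)
    (hinv : ∀ X ∈ hSpace 0, ∀ Y ∈ W, X * Y - Y * X ∈ W) :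
    W = lFac1 ∨ W = lFac2 ∨ W = hSpace 0 ∨ rSpace 0 ≤ W := by
  have hL : ∀ c ∈ sl2, ∀ Y ∈ W, kron c 1 * Y - Y * kron c 1 ∈ W := fun c hc =>
    hinv _ (lFac2_le_hSpace (mem_lFac2_iff.2 ⟨c, hc, rfl⟩))
  have hR : ∀ c ∈ sl2, ∀ Y ∈ W, kron 1 c * Y - Y * kron 1 c ∈ W := fun c hc =>
    hinv _ (lFac1_le_hSpace (mem_lFac1_iff.2 ⟨c, hc, rfl⟩))
  by_cases hr : rSpace 0 ≤ W
  · exact Or.inr (Or.inr (Or.inr hr))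
  have decomposition : ∀ X ∈ W, ∃ a ∈ sl2, ∃ b ∈ sl2,
      kron a 1 ∈ W ∧ kron 1 b ∈ W ∧ X = kron a 1 + kron 1 b := by
    intro X hX
    obtain ⟨a, ha, b, hb, p, hp, q, hq, s, hs, rfl⟩ := exists_kron_decomposition (hW hX)
    obtain ⟨haW, hbW, hrW⟩ := isotypic_components_mem hL hR ha hb hp hq hs hX
    obtain ⟨hpW, hqW, hsW⟩ := weight_components_mem hL hrW
    have vanish : ∀ c ∈ sl2, c ≠ 0 → ∀ d ∈ sl2, kron c d ∈ W → d = 0 := by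
      intro c hc hc0 d hd hcd
      by_contra hd0
      exact hr (rSpace_le_of_kron_mem hL hR hc hc0 hd hd0 hcd)
    refine ⟨a, ha, b, hb, haW, hbW, ?_⟩
    rw [vanish _ sl2E_mem sl2E_ne_zero p hp hpW, vanish _ sl2H_mem sl2H_ne_zero q hq hqW,
      vanish _ sl2F_mem sl2F_ne_zero s hs hsW]
    simp
  have lFac1_le : ∀ b ∈ sl2, b ≠ 0 → kron 1 b ∈ W → lFac1 ≤ W := by
    intro b hb hb0 hbW X hX
    obtain ⟨c, hc, rfl⟩ := mem_lFac1_iff.1 hX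
    exact kron_mem_of_right_mem hR hb hb0 hbW c hc
  have lFac2_le : ∀ a ∈ sl2, a ≠ 0 → kron a 1 ∈ W → lFac2 ≤ W := by
    intro a ha ha0 haW X hX
    obtain ⟨c, hc, rfl⟩ := mem_lFac2_iff.1 hX
    exact kron_mem_of_left_mem hL ha ha0 haW c hc
  have le_hSpace : W ≤ hSpace 0 := by
    intro X hX
    obtain ⟨a, ha, b, hb, -, -, h⟩ := decomposition X hX
    exact mem_hSpace_zero_iff.2 ⟨a, ha, b, hb, h⟩
  have le_lFac1 : ¬ lFac2 ≤ W → W ≤ lFac1 := by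
    intro h2 X hX
    obtain ⟨a, ha, b, hb, haW, -, rfl⟩ := decomposition X hX
    have ha0 : a = 0 := by
      by_contra ha0
      exact h2 (lFac2_le a ha ha0 haW)
    exact mem_lFac1_iff.2 ⟨b, hb, by simp [ha0]⟩
  have le_lFac2 : ¬ lFac1 ≤ W → W ≤ lFac2 := by
    intro h1 X hX
    obtain ⟨a, ha, b, hb, -, hbW, rfl⟩ := decomposition X hX
    have hb0 : b = 0 := by
      by_contra hb0
      exact h1 (lFac1_le b hb hb0 hbW)
    exact mem_lFac2_iff.2 ⟨a, ha, by simp [hb0]⟩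
  by_cases h1 : lFac1 ≤ W
  · by_cases h2 : lFac2 ≤ W
    · exact Or.inr (Or.inr (Or.inl (le_antisymm le_hSpace (hSpace_eq_sup ▸ sup_le h1 h2))))
    · exact Or.inl (le_antisymm (le_lFac1 h2) h1)
  · by_cases h2 : lFac2 ≤ W
    · exact Or.inr (Or.inl (le_antisymm (le_lFac2 h1) h2))
    · exact absurd (eq_bot_iff.2 (lFac1_inf_lFac2 ▸ le_inf (le_lFac1 h2) (le_lFac2 h1))) hW0

/-- structure of 𝔥₁ ≅ 𝔰𝔬(2,2) ≅ 𝔰𝔩₂(ℝ) ⊕ 𝔰𝔩₂(ℝ), and classification of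
the proper nontrivial ad(𝔥₁)-invariant subspaces of 𝔰𝔩₄(ℝ). -/
theorem stmt16 :
    (hSpace 0 = lFac1 ⊔ lFac2) ∧ (lFac1 ⊓ lFac2 = ⊥) ∧
    (lFac1 ≤ hSpace 0) ∧ (lFac2 ≤ hSpace 0) ∧
    (∀ X ∈ hSpace 0, ∀ Y ∈ lFac1, X * Y - Y * X ∈ lFac1) ∧
    (∀ X ∈ hSpace 0, ∀ Y ∈ lFac2, X * Y - Y * X ∈ lFac2) ∧
    (∃ f : M4 →ₗ[ℝ] Matrix (Fin 2) (Fin 2) ℝ,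
      Submodule.map f lFac1 = sl2 ∧ Set.InjOn f (lFac1 : Set M4) ∧
      ∀ X ∈ lFac1, ∀ Y ∈ lFac1, f (X * Y - Y * X) = f X * f Y - f Y * f X) ∧
    (∃ f : M4 →ₗ[ℝ] Matrix (Fin 2) (Fin 2) ℝ,
      Submodule.map f lFac2 = sl2 ∧ Set.InjOn f (lFac2 : Set M4) ∧
      ∀ X ∈ lFac2, ∀ Y ∈ lFac2, f (X * Y - Y * X) = f X * f Y - f Y * f X) ∧
    (∀ W : Submodule ℝ M4, W ≤ sl4 → W ≠ ⊥ → W ≠ sl4 →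
      (∀ X ∈ hSpace 0, ∀ Y ∈ W, X * Y - Y * X ∈ W) →
      W = lFac1 ∨ W = lFac2 ∨ W = hSpace 0 ∨ rSpace 0 ≤ W) := by
  refine ⟨hSpace_eq_sup, lFac1_inf_lFac2, lFac1_le_hSpace, lFac2_le_hSpace,
    fun X hX Y hY => bracket_mem_lFac1 hX hY, fun X hX Y hY => bracket_mem_lFac2 hX hY,
    ⟨{ toFun := fun X => !![X 0 0, X 0 1; X 1 0, X 1 1], map_add' := ?_, map_smul' := ?_ },
      exists_bracket_iso_of_section (kron 1) _ (fun X => mem_lFac1_iff) ?_ ?_⟩,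
    ⟨{ toFun := fun X => !![X 0 0, X 0 2; X 2 0, X 2 2], map_add' := ?_, map_smul' := ?_ },
      exists_bracket_iso_of_section (kron.flip 1) _ (fun X => mem_lFac2_iff) ?_ ?_⟩,
    fun W hW hW0 _ hinv => eq_lFac_or_rSpace_le hW hW0 hinv⟩
  · intro X Y
    ext i j
    fin_cases i <;> fin_cases j <;> rfl
  · intro c X
    ext i j
    fin_cases i <;> fin_cases j <;> rfl
  · intro b
    ext i j
    fin_cases i <;> fin_cases j <;> simp [kron_apply]
  · intro a b
    rw [kron_mul_kron, one_mul]
  · intro X Y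
    ext i j
    fin_cases i <;> fin_cases j <;> rfl
  · intro c X
    ext i j
    fin_cases i <;> fin_cases j <;> rfl
  · intro a
    ext i j
    fin_cases i <;> fin_cases j <;> simp [kron_apply]
  · intro a b
    simp only [LinearMap.flip_apply, kron_mul_kron, one_mul]
end

section
/- Let 𝔤 be a finite-dimensional Lie algebra over ℝ whose Killing form is nondegenerate (equivalently, 𝔤 is semisimple). Let σ : 𝔤 → 𝔤 be a Lie algebra automorphism with σ ∘ σ = id, let 𝔥 = {x ∈ 𝔤 : σ(x) = x} and 𝔮 = {x ∈ 𝔤 : σ(x) = −x}, so that 𝔤 = 𝔥 ⊕ 𝔮 and [𝔮,𝔮] ⊆ 𝔥. If 𝔮 ≠ {0}, then there exist x₁, x₂ ∈ 𝔮 with [x₁, x₂] ≠ 0; in particular, [𝔮,𝔮] ≠ {0}. -/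
/-- A real Lie algebra with nondegenerate Killing form has only the zero abelian ideal. -/
theorem LieIdeal.eq_bot_of_killingForm_nondegenerate {L : Type*} [LieRing L] [LieAlgebra ℝ L]
    [Module.Finite ℝ L] (hK : LinearMap.BilinForm.Nondegenerate (killingForm ℝ L))
    (I : LieIdeal ℝ L) (hI : ∀ x ∈ I, ∀ y ∈ I, ⁅x, y⁆ = 0) : I = ⊥ := by
  have : LieAlgebra.IsKilling ℝ L := by
    refine ⟨?_⟩
    rw [eq_bot_iff]
    intro x hx
    rw [LieIdeal.mem_killingCompl] at hx
    exact (LieSubmodule.mem_bot x).2 (hK.2 x fun y ↦ hx y (LieSubmodule.mem_top y))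
  have : IsLieAbelian I := ⟨fun x y ↦ Subtype.ext (hI x x.2 y y.2)⟩
  exact LieAlgebra.IsKilling.ideal_eq_bot_of_isLieAbelian I

/-- the (−1)-eigenspace 𝔮 of an involution of a semisimple Lie algebra is far
from abelian: if 𝔮 ≠ 0 then [𝔮,𝔮] ≠ 0.  Here 𝔮 = ker(σ + id) = {x : σ x = −x}. -/
theorem stmt17 (L : Type*) [LieRing L] [LieAlgebra ℝ L] [Module.Finite ℝ L]
    (hK : LinearMap.BilinForm.Nondegenerate (killingForm ℝ L))
    (σ : L →ₗ[ℝ] L)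
    (hσb : ∀ x y : L, σ ⁅x, y⁆ = ⁅σ x, σ y⁆)
    (hσ2 : ∀ x : L, σ (σ x) = x)
    (hq : LinearMap.ker (σ + (LinearMap.id : L →ₗ[ℝ] L)) ≠ ⊥) :
    ∃ x₁ ∈ LinearMap.ker (σ + (LinearMap.id : L →ₗ[ℝ] L)),
      ∃ x₂ ∈ LinearMap.ker (σ + (LinearMap.id : L →ₗ[ℝ] L)), ⁅x₁, x₂⁆ ≠ 0 := by
  by_contra! h
  have mem_iff (x : L) : x ∈ LinearMap.ker (σ + (LinearMap.id : L →ₗ[ℝ] L)) ↔ σ x = -x := by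
    simp [add_eq_zero_iff_eq_neg]
  let I : LieIdeal ℝ L :=
    { LinearMap.ker (σ + (LinearMap.id : L →ₗ[ℝ] L)) with
      lie_mem := by
        intro l q (hq' : q ∈ LinearMap.ker (σ + (LinearMap.id : L →ₗ[ℝ] L)))
        have hl : l - σ l ∈ LinearMap.ker (σ + (LinearMap.id : L →ₗ[ℝ] L)) := by
          rw [mem_iff, map_sub, hσ2, neg_sub]
        have hlq := h _ hl q hq'
        rw [sub_lie, sub_eq_zero] at hlq
        change ⁅l, q⁆ ∈ LinearMap.ker (σ + (LinearMap.id : L →ₗ[ℝ] L))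
        rw [mem_iff, hσb, (mem_iff q).1 hq', lie_neg, hlq] }
  have hI : I = ⊥ := LieIdeal.eq_bot_of_killingForm_nondegenerate hK I h
  exact hq ((LieSubmodule.toSubmodule_eq_bot I).2 hI)
end

section
/- Let n ≥ 1 and equip ℝⁿ with the sup norm. Let δ ∈ (0,1), C > 0, and real numbers α, β with 0 < β < α ≤ n. Let F be a finite nonempty subset of the closed unit ball of ℝⁿ such that for every x ∈ ℝⁿ and every r ≥ δ, the number of points of F in the closed ball B̄(x,r) is at most C·r^α·#F. Then for every w ∈ F, Σ over w' ∈ F with w' ≠ w of max{‖w' − w‖, δ}^{−β} is at most 2ⁿ·C·(1 + 1/(1 − 2^{β−α}))·#F. -/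
open scoped Classical

/-- Dyadic induction: if at most `B * r ^ α` of the numbers `t i ≥ δ` are `≤ r` for every `r ≥ δ`,
then the sum of `t i ^ (-β)` over those `i` with `t i ≤ r` is `O(r ^ (α - β))`. -/
theorem sum_rpow_neg_le_of_card_le {ι : Type*} (s : Finset ι) (t : ι → ℝ) {δ B α β : ℝ}
    (hδ : 0 < δ) (hB : 0 ≤ B) (hβ : 0 < β) (hβα : β < α) (ht : ∀ i ∈ s, δ ≤ t i)
    (hcard : ∀ r, δ ≤ r → ((s.filter (fun i => t i ≤ r)).card : ℝ) ≤ B * r ^ α) (m : ℕ) :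
    ∀ r : ℝ, 0 < r → r < 2 ^ m * δ →
      ∑ i ∈ s.filter (fun i => t i ≤ r), t i ^ (-β) ≤
        2 ^ β * B / (1 - 2 ^ (β - α)) * r ^ (α - β) := by
  have hq : (2 : ℝ) ^ (β - α) < 1 :=
    Real.rpow_lt_one_of_one_lt_of_neg one_lt_two (by linarith)
  have hq' : 0 < 1 - (2 : ℝ) ^ (β - α) := by linarith
  have small : ∀ r : ℝ, 0 < r → r < δ →
      ∑ i ∈ s.filter (fun i => t i ≤ r), t i ^ (-β) ≤
        2 ^ β * B / (1 - 2 ^ (β - α)) * r ^ (α - β) := by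
    intro r hr hrδ
    rw [Finset.filter_false_of_mem (fun i hi => by linarith [ht i hi]), Finset.sum_empty]
    positivity
  induction m with
  | zero => exact fun r hr hrδ => small r hr (by simpa using hrδ)
  | succ m ih =>
    intro r hr hrm
    rcases lt_or_ge r δ with hrδ | hrδ
    · exact small r hr hrδ
    have hhalf := ih (r / 2) (by positivity) (by rw [pow_succ] at hrm; linarith)
    have hsplit : ∑ i ∈ s.filter (fun i => t i ≤ r), t i ^ (-β) ≤
        ∑ i ∈ s.filter (fun i => t i ≤ r / 2), t i ^ (-β) +
          ∑ i ∈ s.filter (fun i => t i ≤ r), (r / 2) ^ (-β) := by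
      simp only [Finset.sum_filter, ← Finset.sum_add_distrib]
      refine Finset.sum_le_sum fun i hi => ?_
      have hti : 0 < t i := hδ.trans_le (ht i hi)
      have h1 : 0 < t i ^ (-β) := by positivity
      have h2 : 0 < (r / 2) ^ (-β) := by positivity
      split_ifs with h3 h4 h4
      · linarith
      · rw [zero_add]
        exact Real.rpow_le_rpow_of_nonpos (by positivity) (by linarith) (by linarith)
      · linarith
      · linarith
    have hshell : ∑ i ∈ s.filter (fun i => t i ≤ r), (r / 2) ^ (-β) ≤
        2 ^ β * B * r ^ (α - β) := by
      rw [Finset.sum_const, nsmul_eq_mul]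
      calc _ ≤ B * r ^ α * (r / 2) ^ (-β) := by gcongr; exact hcard r hrδ
        _ = 2 ^ β * B * r ^ (α - β) := by
          rw [Real.div_rpow hr.le zero_le_two, Real.rpow_neg zero_le_two, div_inv_eq_mul,
            sub_eq_add_neg, Real.rpow_add hr]
          ring
    have hscale : (r / 2) ^ (α - β) = 2 ^ (β - α) * r ^ (α - β) := by
      rw [Real.div_rpow hr.le zero_le_two, ← neg_sub α β, Real.rpow_neg zero_le_two]
      ring
    rw [hscale] at hhalf
    calc _ ≤ _ := hsplit.trans (add_le_add hhalf hshell)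
      _ = _ := by
        field_simp
        ring

/-- a Frostman-type condition at scales ≥ δ implies a bound on the modified
β-energy, for β < α.  Here ℝⁿ carries the sup norm (the norm of `Fin n → ℝ`). -/
theorem stmt18 (n : ℕ) (hn : 1 ≤ n) (δ C α β : ℝ)
    (hδ : δ ∈ Set.Ioo (0:ℝ) 1) (hC : 0 < C)
    (hβ : 0 < β) (hβα : β < α) (hα : α ≤ n)
    (F : Finset (Fin n → ℝ)) (hFne : F.Nonempty)
    (hFball : ∀ w ∈ F, ‖w‖ ≤ 1)
    (hFrost : ∀ (x : Fin n → ℝ) (r : ℝ), δ ≤ r →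
      ((F.filter (fun w => ‖w - x‖ ≤ r)).card : ℝ) ≤ C * r ^ α * F.card) :
    ∀ w ∈ F,
      ∑ w' ∈ F.erase w, (max ‖w' - w‖ δ) ^ (-β) ≤
        2 ^ n * C * (1 + 1 / (1 - 2 ^ (β - α))) * F.card := by
  intro w hw
  obtain ⟨hδ0, hδ1⟩ := hδ
  have hcard : ∀ r, δ ≤ r → (((F.erase w).filter (fun w' => max ‖w' - w‖ δ ≤ r)).card : ℝ) ≤
      C * F.card * r ^ α := by
    intro r hr
    refine le_trans ?_ ((hFrost w r hr).trans_eq (by ring))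
    refine Nat.cast_le.mpr (Finset.card_le_card fun x hx => ?_)
    simp only [Finset.mem_filter, Finset.mem_erase, max_le_iff] at hx ⊢
    exact ⟨hx.1.2, hx.2.1⟩
  have hq : (2 : ℝ) ^ (β - α) < 1 :=
    Real.rpow_lt_one_of_one_lt_of_neg one_lt_two (by linarith)
  have hq' : 0 < 1 - (2 : ℝ) ^ (β - α) := by linarith
  obtain ⟨m, hm⟩ := pow_unbounded_of_one_lt (1 / δ) (one_lt_two (α := ℝ))
  have hnear := sum_rpow_neg_le_of_card_le (F.erase w) (fun w' => max ‖w' - w‖ δ) hδ0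
    (by positivity) hβ hβα (fun _ _ => le_max_right _ _) hcard m 1 one_pos ((div_lt_iff₀ hδ0).mp hm)
  have hsplit : ∑ w' ∈ F.erase w, (max ‖w' - w‖ δ) ^ (-β) ≤
      ∑ w' ∈ (F.erase w).filter (fun w' => max ‖w' - w‖ δ ≤ 1), (max ‖w' - w‖ δ) ^ (-β) +
        (F.erase w).card := by
    rw [Finset.sum_filter, Finset.cast_card, ← Finset.sum_add_distrib]
    refine Finset.sum_le_sum fun w' _ => ?_
    split_ifs with h
    · linarith
    · rw [zero_add]
      exact Real.rpow_le_one_of_one_le_of_nonpos (not_le.mp h).le (by linarith)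
  have htotal : ((F.erase w).card : ℝ) ≤ C * F.card * 2 ^ α := by
    have h := hcard 2 (by linarith)
    rwa [Finset.filter_true_of_mem] at h
    intro w' hw'
    refine max_le ?_ (by linarith)
    linarith [norm_sub_le w' w, hFball w hw, hFball w' (Finset.mem_of_mem_erase hw')]
  have hαn : (2 : ℝ) ^ α ≤ 2 ^ n := by
    rw [← Real.rpow_natCast]
    exact Real.rpow_le_rpow_of_exponent_le one_le_two hα
  have hβn : (2 : ℝ) ^ β ≤ 2 ^ n :=
    (Real.rpow_le_rpow_of_exponent_le one_le_two hβα.le).trans hαn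
  rw [Real.one_rpow, mul_one] at hnear
  calc _ ≤ 2 ^ β * (C * F.card) / (1 - 2 ^ (β - α)) + C * F.card * 2 ^ α :=
        hsplit.trans (add_le_add hnear htotal)
    _ ≤ 2 ^ n * (C * F.card) / (1 - 2 ^ (β - α)) + C * F.card * 2 ^ n := by gcongr
    _ = _ := by ring
end

section
/- Let X be a set and let 𝒫₀, 𝒫₁, …, 𝒫ₙ be partitions of X such that for each 1 ≤ i ≤ n every atom of 𝒫ᵢ is contained in an atom of 𝒫_{i−1}. For S ⊆ X write |S|_𝒫 for the number of atoms of a partition 𝒫 that meet S. Let A ⊆ X be nonempty with |A|_{𝒫ₙ} finite, and let σ₁, …, σₙ be real numbers such that for every 1 ≤ i ≤ n and every atom P of 𝒫_{i−1} with P ∩ A ≠ ∅ one has 2^{σᵢ−1} ≤ |A ∩ P|_{𝒫ᵢ} < 2^{σᵢ}. Then: (a) for every 1 ≤ i ≤ n and every atom P of 𝒫_{i−1} meeting A, (1/2)·(|A|_{𝒫ᵢ}/|A|_{𝒫_{i−1}}) ≤ |A ∩ P|_{𝒫ᵢ} ≤ 2·(|A|_{𝒫ᵢ}/|A|_{𝒫_{i−1}});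 (b) for every subset A' ⊆ A and every 1 ≤ i ≤ n, |A'|_{𝒫_{i−1}}/|A|_{𝒫_{i−1}} ≥ (1/2)·(|A'|_{𝒫ᵢ}/|A|_{𝒫ᵢ}). -/
/-- `cnt Part S` = number of atoms of the partition `Part` that meet `S`. -/
noncomputable def cnt {X : Type*} (Part : Set (Set X)) (S : Set X) : ℕ :=
  {p ∈ Part | (p ∩ S).Nonempty}.ncard

/-- The atoms of `Part` that meet `S`. -/
def atomsMeeting {X : Type*} (Part : Set (Set X)) (S : Set X) : Set (Set X) :=
  {p ∈ Part | (p ∩ S).Nonempty}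

theorem cnt_eq_ncard_atomsMeeting {X : Type*} (Part : Set (Set X)) (S : Set X) :
    cnt Part S = (atomsMeeting Part S).ncard := rfl

theorem atomsMeeting_mono {X : Type*} (Part : Set (Set X)) {S T : Set X} (h : S ⊆ T) :
    atomsMeeting Part S ⊆ atomsMeeting Part T :=
  fun _ hp => ⟨hp.1, hp.2.mono (Set.inter_subset_inter_right _ h)⟩

theorem cnt_mono {X : Type*} {Part : Set (Set X)} {S T : Set X} (h : S ⊆ T)
    (hT : (atomsMeeting Part T).Finite) : cnt Part S ≤ cnt Part T :=
  Set.ncard_le_ncard (atomsMeeting_mono Part h) hT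

theorem cnt_pos {X : Type*} {Part : Set (Set X)} {S : Set X} (hcov : ⋃₀ Part = Set.univ)
    (hS : S.Nonempty) (hfin : (atomsMeeting Part S).Finite) : 0 < cnt Part S := by
  obtain ⟨x, hx⟩ := hS
  obtain ⟨p, hp, hxp⟩ := Set.mem_sUnion.1 (hcov ▸ Set.mem_univ x)
  exact (Set.ncard_pos hfin).2 ⟨p, hp, x, hxp, hx⟩

section Refinement

variable {X : Type*} {Q R : Set (Set X)}

/-- An atom of a refinement that meets an atom of the coarser partition lies inside it. -/
theorem subset_of_inter_nonempty (hdisj : ∀ p ∈ Q, ∀ q ∈ Q, p ≠ q → p ∩ q = ∅)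
    (href : ∀ r ∈ R, ∃ p ∈ Q, r ⊆ p) {r p : Set X} (hr : r ∈ R) (hp : p ∈ Q)
    (h : (r ∩ p).Nonempty) : r ⊆ p := by
  obtain ⟨q, hq, hrq⟩ := href r hr
  obtain ⟨x, hxr, hxp⟩ := h
  have hqp : q = p := by
    by_contra hne
    exact Set.notMem_empty x (hdisj q hq p hp hne ▸ ⟨hrq hxr, hxp⟩)
  exact hqp ▸ hrq

theorem atomsMeeting_finite_of_refinement (hdisj : ∀ p ∈ Q, ∀ q ∈ Q, p ≠ q → p ∩ q = ∅)
    (hcov : ⋃₀ R = Set.univ) (href : ∀ r ∈ R, ∃ p ∈ Q, r ⊆ p) {S : Set X}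
    (hfin : (atomsMeeting R S).Finite) : (atomsMeeting Q S).Finite := by
  have key : ∀ p ∈ atomsMeeting Q S, ∃ r ∈ atomsMeeting R S, r ⊆ p ∧ r.Nonempty := by
    rintro p ⟨hp, x, hxp, hxS⟩
    obtain ⟨r, hr, hxr⟩ := Set.mem_sUnion.1 (hcov ▸ Set.mem_univ x)
    exact ⟨r, ⟨hr, x, hxr, hxS⟩,
      subset_of_inter_nonempty hdisj href hr hp ⟨x, hxr, hxp⟩, x, hxr⟩
  choose! f hf hfp hfn using key
  refine Set.Finite.of_injOn (f := f) hf ?_ hfin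
  intro p hp q hq hpq
  by_contra hne
  obtain ⟨x, hx⟩ := hfn p hp
  exact Set.notMem_empty x
    (hdisj p hp.1 q hq.1 hne ▸ ⟨hfp p hp hx, hfp q hq (hpq ▸ hx)⟩)

/-- The atoms of a refinement are counted by summing over the atoms of the coarser partition. -/
theorem cnt_eq_sum_cnt_inter (hdisj : ∀ p ∈ Q, ∀ q ∈ Q, p ≠ q → p ∩ q = ∅)
    (href : ∀ r ∈ R, ∃ p ∈ Q, r ⊆ p) {S : Set X}
    (hR : (atomsMeeting R S).Finite) (hQ : (atomsMeeting Q S).Finite) :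
    cnt R S = ∑ p ∈ hQ.toFinset, cnt R (S ∩ p) := by
  classical
  choose! f hfQ hf using href
  rw [cnt_eq_ncard_atomsMeeting, Set.ncard_eq_toFinset_card _ hR,
    Finset.card_eq_sum_card_fiberwise (f := f) (t := hQ.toFinset)]
  · refine Finset.sum_congr rfl fun p hp => ?_
    have hpQ : p ∈ Q := (hQ.mem_toFinset.1 hp).1
    rw [cnt_eq_ncard_atomsMeeting, ← Set.ncard_coe_finset]
    congr 1
    ext r
    simp only [Finset.coe_filter, Set.Finite.mem_toFinset, Set.mem_ofPred_eq]
    constructor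
    · rintro ⟨⟨hr, x, hxr, hxS⟩, rfl⟩
      exact ⟨hr, x, hxr, hxS, hf r hr hxr⟩
    · rintro ⟨hr, x, hxr, hxS, hxp⟩
      refine ⟨⟨hr, x, hxr, hxS⟩, ?_⟩
      by_contra hne
      exact Set.notMem_empty x (hdisj _ (hfQ r hr) p hpQ hne ▸ ⟨hf r hr hxr, hxp⟩)
  · intro r hr
    obtain ⟨hr, x, hxr, hxS⟩ := hR.mem_toFinset.1 hr
    exact hQ.mem_toFinset.2 ⟨hfQ r hr, x, hf r hr hxr, hxS⟩

theorem mul_cnt_le_cnt (hdisj : ∀ p ∈ Q, ∀ q ∈ Q, p ≠ q → p ∩ q = ∅)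
    (href : ∀ r ∈ R, ∃ p ∈ Q, r ⊆ p) {S : Set X}
    (hR : (atomsMeeting R S).Finite) (hQ : (atomsMeeting Q S).Finite) {c : ℝ}
    (hc : ∀ p ∈ atomsMeeting Q S, c ≤ cnt R (S ∩ p)) : cnt Q S * c ≤ cnt R S := by
  rw [cnt_eq_sum_cnt_inter hdisj href hR hQ, cnt_eq_ncard_atomsMeeting,
    Set.ncard_eq_toFinset_card _ hQ, Nat.cast_sum, ← nsmul_eq_mul]
  exact Finset.card_nsmul_le_sum _ _ _ fun p hp => hc p (hQ.mem_toFinset.1 hp)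

theorem cnt_le_mul_cnt (hdisj : ∀ p ∈ Q, ∀ q ∈ Q, p ≠ q → p ∩ q = ∅)
    (href : ∀ r ∈ R, ∃ p ∈ Q, r ⊆ p) {S : Set X}
    (hR : (atomsMeeting R S).Finite) (hQ : (atomsMeeting Q S).Finite) {c : ℝ}
    (hc : ∀ p ∈ atomsMeeting Q S, cnt R (S ∩ p) ≤ c) : cnt R S ≤ cnt Q S * c := by
  rw [cnt_eq_sum_cnt_inter hdisj href hR hQ, cnt_eq_ncard_atomsMeeting Q,
    Set.ncard_eq_toFinset_card _ hQ, Nat.cast_sum, ← nsmul_eq_mul]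
  exact Finset.sum_le_card_nsmul _ _ _ fun p hp => hc p (hQ.mem_toFinset.1 hp)

end Refinement

/-- regular sets for a filtration of partitions: all atoms at one level carry
comparable counts, and counting ratios for subsets only improve when coarsening. -/
theorem stmt19 {X : Type*} (n : ℕ) (P : ℕ → Set (Set X)) (σ : ℕ → ℝ)
    (hpart : ∀ i ≤ n, (∀ p ∈ P i, p ≠ ∅) ∧
      (∀ p ∈ P i, ∀ q ∈ P i, p ≠ q → p ∩ q = ∅) ∧ ⋃₀ (P i) = Set.univ)
    (href : ∀ i, 1 ≤ i → i ≤ n → ∀ q ∈ P i, ∃ p ∈ P (i-1), q ⊆ p)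
    (A : Set X) (hA : A.Nonempty)
    (hfin : {p ∈ P n | (p ∩ A).Nonempty}.Finite)
    (hreg : ∀ i, 1 ≤ i → i ≤ n → ∀ p ∈ P (i-1), (p ∩ A).Nonempty →
      (2:ℝ) ^ (σ i - 1) ≤ (cnt (P i) (A ∩ p) : ℝ) ∧
      (cnt (P i) (A ∩ p) : ℝ) < (2:ℝ) ^ (σ i)) :
    (∀ i, 1 ≤ i → i ≤ n → ∀ p ∈ P (i-1), (p ∩ A).Nonempty →
      (1/2) * ((cnt (P i) A : ℝ) / (cnt (P (i-1)) A : ℝ)) ≤ (cnt (P i) (A ∩ p) : ℝ) ∧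
      (cnt (P i) (A ∩ p) : ℝ) ≤ 2 * ((cnt (P i) A : ℝ) / (cnt (P (i-1)) A : ℝ))) ∧
    (∀ A' ⊆ A, ∀ i, 1 ≤ i → i ≤ n →
      (1/2) * ((cnt (P i) A' : ℝ) / (cnt (P i) A : ℝ)) ≤
        (cnt (P (i-1)) A' : ℝ) / (cnt (P (i-1)) A : ℝ)) := by
  have hfinite : ∀ i ≤ n, (atomsMeeting (P i) A).Finite := by
    intro i hi
    induction hi using Nat.decreasingInduction with
    | self => exact hfin
    | of_succ k hk ih =>
      exact atomsMeeting_finite_of_refinement (hpart k hk.le).2.1 (hpart (k + 1) hk).2.2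
        (href (k + 1) (Nat.le_add_left 1 k) hk) ih
  have hpos : ∀ i ≤ n, (0 : ℝ) < cnt (P i) A := fun i hi =>
    Nat.cast_pos.2 (cnt_pos (hpart i hi).2.2 hA (hfinite i hi))
  have hσ : ∀ i, (2 : ℝ) ^ σ i = 2 * 2 ^ (σ i - 1) := fun i => by
    rw [Real.rpow_sub_one two_ne_zero]
    ring
  have hlower : ∀ i, 1 ≤ i → i ≤ n →
      cnt (P (i - 1)) A * (2 : ℝ) ^ (σ i - 1) ≤ cnt (P i) A := fun i h1 hi =>
    mul_cnt_le_cnt (hpart (i - 1) (by omega)).2.1 (href i h1 hi) (hfinite i hi)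
      (hfinite (i - 1) (by omega)) fun p hp => (hreg i h1 hi p hp.1 hp.2).1
  have hupper : ∀ A' ⊆ A, ∀ i, 1 ≤ i → i ≤ n →
      (cnt (P i) A' : ℝ) ≤ cnt (P (i - 1)) A' * (2 * (2 : ℝ) ^ (σ i - 1)) := by
    intro A' hA' i h1 hi
    refine cnt_le_mul_cnt (hpart (i - 1) (by omega)).2.1 (href i h1 hi)
      ((hfinite i hi).subset (atomsMeeting_mono _ hA'))
      ((hfinite (i - 1) (by omega)).subset (atomsMeeting_mono _ hA')) fun p hp => ?_
    have hpA := atomsMeeting_mono _ hA' hp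
    have hle : cnt (P i) (A' ∩ p) ≤ cnt (P i) (A ∩ p) :=
      cnt_mono (Set.inter_subset_inter_left _ hA')
        ((hfinite i hi).subset (atomsMeeting_mono _ Set.inter_subset_left))
    calc (cnt (P i) (A' ∩ p) : ℝ) ≤ cnt (P i) (A ∩ p) := Nat.cast_le.2 hle
      _ ≤ 2 * (2 : ℝ) ^ (σ i - 1) := hσ i ▸ (hreg i h1 hi p hpA.1 hpA.2).2.le
  refine ⟨fun i h1 hi p hp hpA => ?_, fun A' hA' i h1 hi => ?_⟩
  · obtain ⟨hl, hu⟩ := hreg i h1 hi p hp hpA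
    rw [hσ] at hu
    have hM := hpos (i - 1) (by omega)
    have hdivl : (2 : ℝ) ^ (σ i - 1) ≤ cnt (P i) A / cnt (P (i - 1)) A := by
      rw [le_div_iff₀ hM, mul_comm]
      exact hlower i h1 hi
    have hdivu : (cnt (P i) A : ℝ) / cnt (P (i - 1)) A ≤ 2 * (2 : ℝ) ^ (σ i - 1) := by
      rw [div_le_iff₀ hM, mul_comm]
      exact hupper A subset_rfl i h1 hi
    constructor <;> linarith
  · have hM := hpos (i - 1) (by omega)
    have hN := hpos i hi
    rw [← mul_div_assoc, div_le_div_iff₀ hN hM]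
    have hu := mul_le_mul_of_nonneg_right (hupper A' hA' i h1 hi) hM.le
    have hl := mul_le_mul_of_nonneg_left (hlower i h1 hi)
      (Nat.cast_nonneg (α := ℝ) (cnt (P (i - 1)) A'))
    linarith
end
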